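/- Let n ≥ 1, let λ ∈ ℝ, and let R : Fin n → Fin n → Fin n → Fin n → ℂ be a Kähler curvature array satisfying the Einstein condition ∑_{k} R i j k k = λ·δ_{ij} for all i, j. Then ∑_{i,j,k,l} |R i j k l|² ≥ 2λ²n/(n+1), with equality if and only if R i j k l = (λ/(n+1))·(δ_{ij}·δ_{kl} + δ_{il}·δ_{kj}) for all indices i, j, k, l (i.e. if and only if the curvature is that of a metric of constant holomorphic sectional curvature). -/

import Mathlib

/-- The curvature components of constant holomorphic sectional curvature `2`:
`δ_{ij} δ_{kl} + δ_{il} δ_{kj}`. -/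
def constHolCurv {n : ℕ} (i j k l : Fin n) : ℝ :=
  (if i = j then 1 else 0) * (if k = l then 1 else 0) +
    (if i = l then 1 else 0) * (if k = j then 1 else 0)

lemma sum_constHolCurv_mul {n : ℕ} (f : Fin n → Fin n → Fin n → Fin n → ℝ) :
    ∑ i, ∑ j, ∑ k, ∑ l, constHolCurv i j k l * f i j k l =
      ∑ i, ∑ k, f i i k k + ∑ i, ∑ k, f i k k i := by
  simp only [constHolCurv, add_mul, Finset.sum_add_distrib]
  congr 1
  · refine Finset.sum_congr rfl fun i _ => ?_
    simp
  · refine Finset.sum_congr rfl fun i _ => Finset.sum_congr rfl fun j _ => ?_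
    simp

lemma sum_constHolCurv_sq (n : ℕ) :
    ∑ i : Fin n, ∑ j : Fin n, ∑ k : Fin n, ∑ l : Fin n,
      constHolCurv i j k l * constHolCurv i j k l = 2 * n * (n + 1) := by
  rw [sum_constHolCurv_mul]
  simp [constHolCurv, Finset.sum_add_distrib]
  ring

lemma normSq_sub_ofReal_mul (z : ℂ) (c s : ℝ) :
    Complex.normSq (z - c * s) =
      Complex.normSq z - 2 * c * (s * z.re) + c ^ 2 * (s * s) := by
  simp [Complex.normSq_apply]
  ring

/-- The squared distance from a Kähler–Einstein curvature array to its constant holomorphic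
sectional curvature model. -/
lemma sum_normSq_sub_constHolCurv {n : ℕ} (lam : ℝ)
    (R : Fin n → Fin n → Fin n → Fin n → ℂ)
    (h2 : ∀ i j k l, R i j k l = R i l k j)
    (hE : ∀ i j, ∑ k, R i j k k = (lam : ℂ) * (if i = j then 1 else 0)) :
    ∑ i, ∑ j, ∑ k, ∑ l,
        Complex.normSq (R i j k l - ((lam / (n + 1) : ℝ) : ℂ) * (constHolCurv i j k l : ℝ)) =
      (∑ i, ∑ j, ∑ k, ∑ l, Complex.normSq (R i j k l)) - 2 * lam ^ 2 * n / (n + 1) := by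
  have hscal : ∑ i, ∑ k, (R i i k k).re = n * lam := by
    simp [← Complex.re_sum, hE]
  have hscal' : ∑ i, ∑ k, (R i k k i).re = n * lam := by
    rw [← hscal]
    exact Finset.sum_congr rfl fun i _ => Finset.sum_congr rfl fun k _ => by rw [h2]
  have hn : (n + 1 : ℝ) ≠ 0 := by positivity
  simp only [normSq_sub_ofReal_mul, Finset.sum_add_distrib, Finset.sum_sub_distrib,
    ← Finset.mul_sum, sum_constHolCurv_sq]
  rw [sum_constHolCurv_mul fun i j k l => (R i j k l).re, hscal, hscal']
  field_simp
  ring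


/-- If `R` is a Kähler curvature array satisfying the Einstein condition
`∑ₖ R i j k k = λ δ_{ij}`, then `∑ |R i j k l|² ≥ 2λ²n/(n+1)`, with equality iff
`R i j k l = (λ/(n+1))(δ_{ij} δ_{kl} + δ_{il} δ_{kj})` for all indices, i.e. iff the
curvature is that of a metric of constant holomorphic sectional curvature. -/
theorem normSq_curvature_ge (n : ℕ) (hn : 1 ≤ n) (lam : ℝ)
    (R : Fin n → Fin n → Fin n → Fin n → ℂ)
    (h1 : ∀ i j k l, R i j k l = R k j i l)
    (h2 : ∀ i j k l, R i j k l = R i l k j)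
    (h3 : ∀ i j k l, starRingEnd ℂ (R i j k l) = R j i l k)
    (hE : ∀ i j, ∑ k, R i j k k = (lam : ℂ) * (if i = j then 1 else 0)) :
    (∑ i, ∑ j, ∑ k, ∑ l, Complex.normSq (R i j k l)) ≥ 2 * lam ^ 2 * n / (n + 1) ∧
      ((∑ i, ∑ j, ∑ k, ∑ l, Complex.normSq (R i j k l)) = 2 * lam ^ 2 * n / (n + 1) ↔
        ∀ i j k l, R i j k l =
          ((lam / (n + 1) : ℝ) : ℂ) *
            ((if i = j then 1 else 0) * (if k = l then 1 else 0) +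
              (if i = l then 1 else 0) * (if k = j then 1 else 0))) := by
  have key := sum_normSq_sub_constHolCurv lam R h2 hE
  have hnn : ∀ i j k l, 0 ≤ Complex.normSq
      (R i j k l - ((lam / (n + 1) : ℝ) : ℂ) * (constHolCurv i j k l : ℝ)) :=
    fun _ _ _ _ => Complex.normSq_nonneg _
  refine ⟨?_, ?_⟩
  · rw [ge_iff_le, ← sub_nonneg, ← key]
    exact Finset.sum_nonneg fun i _ => Finset.sum_nonneg fun j _ =>
      Finset.sum_nonneg fun k _ => Finset.sum_nonneg fun l _ => hnn i j k l
  · rw [← sub_eq_zero, ← key, Fintype.sum_eq_zero_iff_of_nonneg fun i =>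
      Finset.sum_nonneg fun j _ => Finset.sum_nonneg fun k _ =>
        Finset.sum_nonneg fun l _ => hnn i j k l, funext_iff]
    refine forall_congr' fun i => ?_
    rw [Pi.zero_apply, Fintype.sum_eq_zero_iff_of_nonneg fun j =>
      Finset.sum_nonneg fun k _ => Finset.sum_nonneg fun l _ => hnn i j k l, funext_iff]
    refine forall_congr' fun j => ?_
    rw [Pi.zero_apply, Fintype.sum_eq_zero_iff_of_nonneg fun k =>
      Finset.sum_nonneg fun l _ => hnn i j k l, funext_iff]
    refine forall_congr' fun k => ?_
    rw [Pi.zero_apply, Fintype.sum_eq_zero_iff_of_nonneg fun l => hnn i j k l, funext_iff]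
    refine forall_congr' fun l => ?_
    rw [Pi.zero_apply, Complex.normSq_eq_zero, sub_eq_zero]
    simp only [constHolCurv, Complex.ofReal_add, Complex.ofReal_mul, apply_ite Complex.ofReal,
      Complex.ofReal_one, Complex.ofReal_zero]
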